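/- Let k, t, K be positive integers and ε > 0. Then there exists a positive integer M = M(k, t, K, ε) such that for every connected, locally finite, vertex-transitive graph G satisfying β_G(2n) ≤ K·β_G(n) for all n ∈ ℕ, and for all integers m, r ≥ M, one has β_G(r(m-t)) ≥ (1-ε)·β_G((r+1)m + k). -/

import Mathlib

universe u

namespace PercStmt

/-- A graph is vertex-transitive if any vertex can be mapped to any other by an automorphism. -/
def VertexTransitive {V : Type u} (G : SimpleGraph V) : Prop :=
  ∀ u v : V, ∃ φ : G ≃g G, φ u = v

/-- `β_G(r)`: the number of vertices at distance at most `r` from `v`. -/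
noncomputable def ballCard {V : Type u} (G : SimpleGraph V) (v : V) (r : ℕ) : ℕ :=
  Nat.card {u : V | G.Reachable v u ∧ G.dist v u ≤ r}

section Balls

variable {V : Type u} {G : SimpleGraph V}

lemma ballCard_eq_ncard (hG : G.Connected) (v : V) (r : ℕ) :
    ballCard G v r = {u | G.dist v u ≤ r}.ncard := by
  simp only [ballCard, hG.preconnected v, true_and]
  exact Nat.card_coe_set_eq _

lemma dist_iso_le (hG : G.Connected) (φ : G ≃g G) (u v : V) :
    G.dist (φ u) (φ v) ≤ G.dist u v := by
  obtain ⟨p, hp⟩ := hG.exists_walk_length_eq_dist u v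
  have h := SimpleGraph.dist_le (p.map φ.toHom)
  rw [SimpleGraph.Walk.length_map, hp] at h
  exact h

lemma dist_iso (hG : G.Connected) (φ : G ≃g G) (u v : V) :
    G.dist (φ u) (φ v) = G.dist u v := by
  refine le_antisymm (dist_iso_le hG φ u v) ?_
  simpa using dist_iso_le hG φ.symm (φ u) (φ v)

lemma ballCard_eq_of_vertexTransitive (hG : G.Connected) (hT : VertexTransitive G)
    (u v : V) (r : ℕ) : ballCard G u r = ballCard G v r := by
  obtain ⟨φ, rfl⟩ := hT u v
  rw [ballCard_eq_ncard hG, ballCard_eq_ncard hG,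
    ← Set.ncard_image_of_injective {w | G.dist u w ≤ r} φ.injective]
  congr 1
  ext w
  constructor
  · rintro ⟨x, hx, rfl⟩
    simpa [dist_iso hG] using hx
  · intro hw
    refine ⟨φ.symm w, ?_, by simp⟩
    simpa [dist_iso hG] using (dist_iso_le hG φ.symm (φ u) w).trans hw

/-- Every point of a geodesic splits it into two geodesics. -/
lemma exists_dist_eq_of_le (hG : G.Connected) (v x : V) {i : ℕ} (hi : i ≤ G.dist v x) :
    ∃ y, G.dist v y = i ∧ G.dist y x = G.dist v x - i := by
  obtain ⟨p, hp⟩ := hG.exists_walk_length_eq_dist v x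
  have h₁ := SimpleGraph.dist_le (p.take i)
  have h₂ := SimpleGraph.dist_le (p.drop i)
  rw [SimpleGraph.Walk.take_length] at h₁
  rw [SimpleGraph.Walk.drop_length] at h₂
  have h₃ := hG.dist_triangle (u := v) (v := p.getVert i) (w := x)
  exact ⟨p.getVert i, by omega, by omega⟩

lemma finite_dist_le (hG : G.Connected) (hF : G.LocallyFinite) (v : V) (r : ℕ) :
    {u | G.dist v u ≤ r}.Finite := by
  induction r with
  | zero => simp [hG.dist_eq_zero_iff]
  | succ r ih =>
    refine (ih.union (ih.biUnion fun u _ => @Set.toFinite _ (G.neighborSet u)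
      (@Finite.of_fintype _ (hF u)))).subset fun x hx => ?_
    by_cases hxr : G.dist v x ≤ r
    · exact Or.inl hxr
    · obtain ⟨y, hy, hyx⟩ := exists_dist_eq_of_le hG v x (i := r) (by omega)
      have hx' : G.dist v x ≤ r + 1 := hx
      have hadj : G.Adj y x := SimpleGraph.dist_eq_one_iff_adj.mp (by omega)
      exact Or.inr (Set.mem_biUnion (show G.dist v y ≤ r from hy.le) hadj)

lemma ballCard_mono (hG : G.Connected) (hF : G.LocallyFinite) (v : V) :
    Monotone (ballCard G v) := fun r s h => by
  rw [ballCard_eq_ncard hG, ballCard_eq_ncard hG]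
  exact Set.ncard_le_ncard (fun u hu => le_trans hu h) (finite_dist_le hG hF v s)

lemma ballCard_pos (hG : G.Connected) (hF : G.LocallyFinite) (v : V) (r : ℕ) :
    0 < ballCard G v r := by
  rw [ballCard_eq_ncard hG, Set.ncard_pos (finite_dist_le hG hF v r)]
  exact ⟨v, by simp⟩

/-- Each point of an outer annulus of width `s` lies close to a ball of radius `s` contained in the
adjacent inner annulus of width `4 * s`; count such incidences in two ways. -/
lemma annulus_mul_ballCard_le (hG : G.Connected) (hF : G.LocallyFinite) (hT : VertexTransitive G)
    (v : V) {s R : ℕ} (hs : 0 < s) (hR : 5 * s ≤ R) :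
    (ballCard G v R - ballCard G v (R - s)) * ballCard G v s ≤
      (ballCard G v (R - s) - ballCard G v (R - 5 * s)) * ballCard G v (4 * s) := by
  classical
  let B (u : V) (r : ℕ) : Finset V := (finite_dist_le hG hF u r).toFinset
  have hB (u x : V) (r : ℕ) : x ∈ B u r ↔ G.dist u x ≤ r := by simp [B]
  have hcard (u : V) (r : ℕ) : ballCard G v r = (B u r).card := by
    rw [ballCard_eq_of_vertexTransitive hG hT v u, ballCard_eq_ncard hG,
      Set.ncard_eq_toFinset_card _ (finite_dist_le hG hF u r)]
  have hsub {r r' : ℕ} (h : r ≤ r') : B v r ⊆ B v r' := fun x hx => by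
    rw [hB] at hx ⊢
    exact hx.trans h
  rw [hcard v R, hcard v (R - s), hcard v (R - 5 * s),
    ← Finset.card_sdiff_of_subset (hsub (Nat.sub_le R s)),
    ← Finset.card_sdiff_of_subset (hsub (by omega))]
  have hy (x : V) : ∃ y, R - s < G.dist v x →
      G.dist v y = R - 3 * s ∧ G.dist y x = G.dist v x - (R - 3 * s) := by
    by_cases hx : R - s < G.dist v x
    · obtain ⟨y, h⟩ := exists_dist_eq_of_le hG v x (i := R - 3 * s) (by omega)
      exact ⟨y, fun _ => h⟩
    · exact ⟨x, fun h => absurd h hx⟩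
  choose y hy using hy
  refine Finset.card_mul_le_card_mul (fun x z => G.dist v x ≤ R ∧ R - s < G.dist v x ∧
    G.dist (y x) z ≤ s) (fun x hx => ?_) fun z _ => ?_
  · rw [hcard (y x) s]
    refine Finset.card_le_card fun z hz => ?_
    simp only [Finset.mem_sdiff, hB, not_le] at hx hz
    simp only [Finset.mem_bipartiteAbove, Finset.mem_sdiff, hB, not_le]
    obtain ⟨h₁, -⟩ := hy x hx.2
    have h₂ := hG.dist_triangle (u := v) (v := y x) (w := z)
    have h₃ := hG.dist_triangle (u := v) (v := z) (w := y x)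
    rw [G.dist_comm (u := z)] at h₃
    omega
  · rw [hcard z (4 * s)]
    refine Finset.card_le_card fun x hx => ?_
    simp only [Finset.mem_bipartiteBelow, hB] at hx ⊢
    obtain ⟨-, h₁, h₂, h₃⟩ := hx
    obtain ⟨-, h₄⟩ := hy x h₂
    have h₅ := hG.dist_triangle (u := z) (v := y x) (w := x)
    rw [G.dist_comm (u := z) (v := y x)] at h₅
    omega

end Balls

/-- A function whose increments over `[R - s, R]` are controlled by those over
`[R - 5 * s, R - s]` has increments decaying like a power of `s / R`. -/
lemma increment_le_pow {f : ℕ → ℝ} (hf : ∀ n, 0 ≤ f n) {C : ℝ} (hC : 0 ≤ C) {R : ℕ}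
    (h : ∀ s, 0 < s → 5 * s ≤ R → f R - f (R - s) ≤ C * (f (R - s) - f (R - 5 * s))) (j : ℕ) :
    ∀ s, 0 < s → 5 ^ j * s ≤ R → f R - f (R - s) ≤ (C / (1 + C)) ^ j * f R := by
  induction j with
  | zero => exact fun s _ _ => by linarith [hf (R - s)]
  | succ j ih =>
    intro s hs hR
    have hR' : 5 ^ j * (5 * s) ≤ R := by rw [← mul_assoc, ← pow_succ]; exact hR
    have h₁ := ih (5 * s) (by omega) hR'
    have h₂ := h s hs ((Nat.le_mul_of_pos_left _ (by positivity)).trans hR')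
    calc f R - f (R - s) ≤ C / (1 + C) * (f R - f (R - 5 * s)) := by
          rw [div_mul_eq_mul_div, le_div_iff₀ (by positivity)]
          linarith
      _ ≤ C / (1 + C) * ((C / (1 + C)) ^ j * f R) := by gcongr
      _ = (C / (1 + C)) ^ (j + 1) * f R := by ring

/-- For all positive integers `k, t, K` and every `ε > 0` there is a
positive integer `M = M(k,t,K,ε)` such that for every connected, locally finite,
vertex-transitive graph `G` with `β_G(2n) ≤ K·β_G(n)` for all `n`, and all integers
`m, r ≥ M`, one has `β_G(r(m-t)) ≥ (1-ε)·β_G((r+1)m + k)`. -/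
theorem stmt12 (k t K : ℕ) (hk : 0 < k) (ht : 0 < t) (hK : 0 < K)
    (ε : ℝ) (hε : 0 < ε) :
    ∃ M : ℕ, 0 < M ∧
      ∀ (V : Type u) (G : SimpleGraph V) (v : V),
        G.Connected → G.LocallyFinite → VertexTransitive G →
        (∀ n : ℕ, (ballCard G v (2 * n) : ℝ) ≤ (K : ℝ) * ballCard G v n) →
        ∀ m r : ℕ, M ≤ m → M ≤ r →
          (1 - ε) * (ballCard G v ((r + 1) * m + k) : ℝ) ≤ ballCard G v (r * (m - t)) := by
  set C : ℝ := (K : ℝ) ^ 2 with hCdef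
  have hC : 0 ≤ C := by positivity
  obtain ⟨j, hj⟩ := exists_pow_lt_of_lt_one hε
    (show C / (1 + C) < 1 by rw [div_lt_one (by positivity)]; linarith)
  refine ⟨2 * 5 ^ j * (t + k), by positivity, fun V G v hG hF hT hD m r hm hr => ?_⟩
  set R := (r + 1) * m + k with hRdef
  have hmono := ballCard_mono hG hF v
  have hann (s : ℕ) (hs : 0 < s) (hR : 5 * s ≤ R) :
      (ballCard G v R : ℝ) - ballCard G v (R - s) ≤
        C * (ballCard G v (R - s) - ballCard G v (R - 5 * s)) := by
    have h₁ := annulus_mul_ballCard_le hG hF hT v hs hR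
    have hpos : (0 : ℝ) < ballCard G v s := by exact_mod_cast ballCard_pos hG hF v s
    have h₂ : (ballCard G v (4 * s) : ℝ) ≤ C * ballCard G v s := by
      have h₃ := hD (2 * s)
      rw [← mul_assoc] at h₃
      calc (ballCard G v (4 * s) : ℝ) ≤ K * ballCard G v (2 * s) := h₃
        _ ≤ K * (K * ballCard G v s) := by gcongr; exact hD s
        _ = C * ballCard G v s := by rw [hCdef]; ring
    have hle : ballCard G v (R - 5 * s) ≤ ballCard G v (R - s) := hmono (by omega)
    rify [hmono (Nat.sub_le R s), hle] at h₁
    refine le_of_mul_le_mul_right (h₁.trans ?_) hpos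
    rw [mul_comm C, mul_assoc]
    exact mul_le_mul_of_nonneg_left h₂ (sub_nonneg.mpr (Nat.cast_le.mpr hle))
  have hN : 1 ≤ 5 ^ j := Nat.one_le_pow _ _ (by norm_num)
  have htm : t ≤ m := by nlinarith
  have hsub : R - (m + r * t + k) = r * (m - t) := by
    obtain ⟨d, rfl⟩ := Nat.exists_eq_add_of_le htm
    rw [hRdef, Nat.add_sub_cancel_left]
    apply Nat.sub_eq_of_eq_add
    ring
  have hwidth : 5 ^ j * (m + r * t + k) ≤ R := by
    have hr0 : 0 < r := lt_of_lt_of_le (by positivity) hr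
    have hm2 : 2 * (5 ^ j * m) ≤ r * m := by
      calc 2 * (5 ^ j * m) ≤ 2 * 5 ^ j * (t + k) * m := by
            rw [← mul_assoc]
            exact Nat.mul_le_mul_right m (Nat.le_mul_of_pos_right _ (by omega))
        _ ≤ r * m := by gcongr
    have hrt : 2 * (5 ^ j * (r * t + k)) ≤ r * m := by
      calc 2 * (5 ^ j * (r * t + k)) ≤ 2 * (5 ^ j * (r * t + r * k)) := by
            gcongr; exact Nat.le_mul_of_pos_left _ hr0
        _ = r * (2 * 5 ^ j * (t + k)) := by ring
        _ ≤ r * m := by gcongr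
    rw [hRdef]
    nlinarith
  have hmain := increment_le_pow (f := fun n => (ballCard G v n : ℝ)) (fun n => by positivity)
    hC hann j _ (by omega) hwidth
  simp only [hsub] at hmain
  nlinarith [(Nat.cast_nonneg (ballCard G v R) : (0 : ℝ) ≤ _)]

end PercStmt
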